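/- Let C be a field equipped with a nonarchimedean (ultrametric) multiplicative norm extending the p-adic absolute value on ℚ_p, assume C is complete, and assume that every element of C has a p-th root in C. Then the map z ↦ log(1+z) from {z ∈ C : ‖z‖ < 1} to C is surjective: for every c ∈ C there exists z ∈ C with ‖z‖ < 1 and log(1+z) = c. -/

import Mathlib

/-- `log1p z` is the sum of the series `Σ_{n ≥ 1} (-1)^(n-1) z^n / n`, i.e. `log (1 + z)`. -/
noncomputable def log1p {C : Type*} [NormedField C] (z : C) : C :=
  ∑' n : ℕ, (-1) ^ n * z ^ (n + 1) / ((n : C) + 1)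

open Filter Topology Metric

lemma norm_sub_le_max_norm {E : Type*} [SeminormedAddGroup E] [IsUltrametricDist E] (x y : E) :
    ‖x - y‖ ≤ max ‖x‖ ‖y‖ := by
  simpa [sub_eq_add_neg] using IsUltrametricDist.norm_add_le_max x (-y)

section PadicField

variable (p : ℕ) [Fact p.Prime] {C : Type*} [NormedField C]

lemma norm_natCast_add_one_inv_le [NormedAlgebra ℚ_[p] C] (n : ℕ) :
    ‖((n : C) + 1)⁻¹‖ ≤ n + 1 := by
  have h : (n : C) + 1 = algebraMap ℚ_[p] C ((n + 1 : ℕ) : ℚ_[p]) := by simp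
  rw [norm_inv, h, norm_algebraMap',
    Padic.norm_eq_zpow_neg_valuation (Nat.cast_ne_zero.2 n.succ_ne_zero),
    Padic.valuation_natCast, zpow_neg, inv_inv, zpow_natCast]
  exact_mod_cast Nat.le_of_dvd n.succ_pos pow_padicValNat_dvd

lemma norm_natCast_self_lt_one [NormedAlgebra ℚ_[p] C] : ‖(p : C)‖ < 1 := by
  rw [← map_natCast (algebraMap ℚ_[p] C), norm_algebraMap']
  exact Padic.norm_p_lt_one

lemma summable_add_one_mul_pow {r : ℝ} (h0 : 0 ≤ r) (h1 : r < 1) :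
    Summable fun n : ℕ ↦ ((n : ℝ) + 1) * r ^ (n + 1) := by
  have h := summable_pow_mul_geometric_of_norm_lt_one 1
    (show ‖r‖ < 1 by rwa [Real.norm_of_nonneg h0])
  simpa using (summable_nat_add_iff 1).2 h

lemma summable_log1p_term [NormedAlgebra ℚ_[p] C] [CompleteSpace C] {z : C} (hz : ‖z‖ < 1) :
    Summable fun n : ℕ ↦ (-1) ^ n * z ^ (n + 1) / ((n : C) + 1) := by
  refine .of_norm_bounded (summable_add_one_mul_pow (norm_nonneg z) hz) fun n ↦ ?_
  rw [div_eq_mul_inv, norm_mul, norm_mul, norm_pow, norm_neg, norm_one, one_pow, one_mul, norm_pow,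
    mul_comm]
  gcongr
  exact norm_natCast_add_one_inv_le p n

/-- `C(p^m, j+1) / p^m = C(p^m - 1, j) / (j+1)`. -/
lemma choose_prime_pow_div [CharZero C] (m j : ℕ) :
    ((p ^ m).choose (j + 1) : C) / (p : C) ^ m = ((p ^ m - 1).choose j : C) * ((j : C) + 1)⁻¹ := by
  have hp : (p : C) ^ m ≠ 0 := pow_ne_zero _ (Nat.cast_ne_zero.2 (Fact.out : p.Prime).ne_zero)
  have hj : (j : C) + 1 ≠ 0 := Nat.cast_add_one_ne_zero j
  have h := Nat.add_one_mul_choose_eq (p ^ m - 1) j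
  rw [Nat.sub_add_cancel (Nat.pow_pos (Fact.out : p.Prime).pos)] at h
  have h' : (p : C) ^ m * ((p ^ m - 1).choose j : C)
      = ((p ^ m).choose (j + 1) : C) * ((j : C) + 1) := by exact_mod_cast h
  field_simp
  linear_combination -h'

lemma one_add_pow_sub_one_div_eq_tsum (z a : C) (m : ℕ) :
    ((1 + z) ^ m - 1) / a = ∑' j : ℕ, z ^ (j + 1) * ((m.choose (j + 1) : C) / a) := by
  rw [tsum_eq_sum (s := Finset.range m), add_comm, add_pow, Finset.sum_range_succ']
  · simp [Finset.sum_div, mul_div_assoc]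
  · intro j hj
    rw [Nat.choose_eq_zero_of_lt (by simpa [Nat.lt_succ_iff] using hj)]
    simp

variable [IsUltrametricDist C]

lemma tendsto_choose_prime_pow_sub_one [NormedAlgebra ℚ_[p] C] [CharZero C] (j : ℕ) :
    Tendsto (fun m : ℕ ↦ ((p ^ m - 1).choose j : C)) atTop (𝓝 ((-1) ^ j)) := by
  induction j with
  | zero => simp
  | succ j ih =>
    have hp0 : Tendsto (fun m : ℕ ↦ (p : C) ^ m) atTop (𝓝 0) :=
      tendsto_pow_atTop_nhds_zero_of_norm_lt_one (norm_natCast_self_lt_one p)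
    have h : Tendsto (fun m : ℕ ↦ (p : C) ^ m * (((p ^ m - 1).choose j : C) * ((j : C) + 1)⁻¹)
        - ((p ^ m - 1).choose j : C)) atTop (𝓝 (0 * ((-1) ^ j * ((j : C) + 1)⁻¹) - (-1) ^ j)) :=
      (hp0.mul (ih.mul_const _)).sub ih
    rw [zero_mul, zero_sub, ← neg_one_mul, ← pow_succ'] at h
    refine h.congr fun m ↦ ?_
    have hp : (p : C) ^ m ≠ 0 := pow_ne_zero _ (Nat.cast_ne_zero.2 (Fact.out : p.Prime).ne_zero)
    have hs := Nat.choose_succ_succ' (p ^ m - 1) j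
    rw [Nat.sub_add_cancel (Nat.pow_pos (Fact.out : p.Prime).pos)] at hs
    rw [← choose_prime_pow_div, mul_div_cancel₀ _ hp, hs]
    push_cast
    ring

/-- The logarithm is the limit of `((1 + z) ^ (p ^ m) - 1) / p ^ m`. -/
lemma tendsto_log1p [NormedAlgebra ℚ_[p] C] [CharZero C] [CompleteSpace C] {z : C}
    (hz : ‖z‖ < 1) :
    Tendsto (fun m : ℕ ↦ ((1 + z) ^ p ^ m - 1) / (p : C) ^ m) atTop (𝓝 (log1p z)) := by
  simp_rw [one_add_pow_sub_one_div_eq_tsum]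
  refine tendsto_tsum_of_dominated_convergence
    (summable_add_one_mul_pow (norm_nonneg z) hz) (fun j ↦ ?_) (.of_forall fun m j ↦ ?_)
  · simp_rw [choose_prime_pow_div]
    convert ((tendsto_choose_prime_pow_sub_one p j).mul_const ((j : C) + 1)⁻¹).const_mul
      (z ^ (j + 1)) using 2
    ring
  · rw [choose_prime_pow_div, norm_mul, norm_mul, norm_pow, mul_comm]
    gcongr
    exact (mul_le_of_le_one_left (norm_nonneg _) (IsUltrametricDist.norm_natCast_le_one C _)).trans
      (norm_natCast_add_one_inv_le p j)

lemma norm_pow_succ_sub_pow_succ_le {x y : C} {r : ℝ} (hx : ‖x‖ ≤ r) (hy : ‖y‖ ≤ r) (n : ℕ) :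
    ‖x ^ (n + 1) - y ^ (n + 1)‖ ≤ r ^ n * ‖x - y‖ := by
  have hr : 0 ≤ r := (norm_nonneg x).trans hx
  rw [← geom_sum₂_mul, norm_mul]
  gcongr
  refine IsUltrametricDist.norm_sum_le_of_forall_le_of_nonneg (by positivity) fun i hi ↦ ?_
  rw [norm_mul, norm_pow, norm_pow]
  calc ‖x‖ ^ i * ‖y‖ ^ (n + 1 - 1 - i) ≤ r ^ i * r ^ (n + 1 - 1 - i) := by gcongr
    _ = r ^ n := by
      rw [← pow_add]
      congr 1
      have := Finset.mem_range.1 hi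
      omega

lemma log1p_one_add_pow_sub_one [NormedAlgebra ℚ_[p] C] [CharZero C] [CompleteSpace C] {z : C}
    (hz : ‖z‖ < 1) (k : ℕ) : log1p ((1 + z) ^ p ^ k - 1) = (p : C) ^ k * log1p z := by
  have h1 : ‖1 + z‖ ≤ 1 := (IsUltrametricDist.norm_add_le_max _ _).trans (by simp [hz.le])
  have hw : ‖(1 + z) ^ p ^ k - 1‖ < 1 := by
    have h := norm_pow_succ_sub_pow_succ_le h1 norm_one.le (p ^ k - 1)
    rw [Nat.sub_add_cancel (Nat.pow_pos (Fact.out : p.Prime).pos)] at h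
    simp only [one_pow, one_mul, add_sub_cancel_left] at h
    exact h.trans_lt hz
  have h := ((tendsto_log1p p hz).comp (tendsto_add_atTop_nat k)).const_mul ((p : C) ^ k)
  refine tendsto_nhds_unique (tendsto_log1p p hw) (h.congr fun m ↦ ?_)
  have hp : (p : C) ≠ 0 := Nat.cast_ne_zero.2 (Fact.out : p.Prime).ne_zero
  simp only [Function.comp_apply, add_sub_cancel, ← pow_mul]
  rw [pow_add p, mul_comm (p ^ k), pow_add]
  field_simp

lemma norm_sub_one_lt_one_of_norm_pow_sub_one_lt_one (hp : ‖(p : C)‖ < 1) {y : C}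
    (h : ‖y ^ p - 1‖ < 1) : ‖y - 1‖ < 1 := by
  have hpp : p.Prime := Fact.out
  have hy : ‖y‖ ≤ 1 := by
    have : ‖y ^ p‖ ≤ 1 := by
      rw [← sub_add_cancel (y ^ p) 1]
      exact (IsUltrametricDist.norm_add_le_max _ _).trans (by simp [h.le])
    rwa [norm_pow, pow_le_one_iff_of_nonneg (norm_nonneg _) hpp.ne_zero] at this
  have hu : ‖y - 1‖ ≤ 1 := (norm_sub_le_max_norm _ _).trans (by simp [hy])
  have key := add_pow_prime_eq hpp (y - 1) 1
  set S := ∑ k ∈ Finset.Ioo 0 p, (y - 1) ^ (k - 1) * 1 ^ (p - k - 1) * ((p.choose k / p : ℕ) : C)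
  have hS : ‖S‖ ≤ 1 := by
    refine IsUltrametricDist.norm_sum_le_of_forall_le_of_nonneg zero_le_one fun k _ ↦ ?_
    rw [one_pow, mul_one, norm_mul, norm_pow]
    exact mul_le_one₀ (pow_le_one₀ (norm_nonneg _) hu) (norm_nonneg _)
      (IsUltrametricDist.norm_natCast_le_one C _)
  have hpow : (y - 1) ^ p = (y ^ p - 1) - p * ((y - 1) * S) := by
    rw [sub_add_cancel, one_pow] at key
    linear_combination -key
  have hlt : ‖y - 1‖ ^ p < 1 := by
    rw [← norm_pow, hpow]
    refine (norm_sub_le_max_norm _ _).trans_lt (max_lt h ?_)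
    rw [norm_mul, norm_mul]
    exact (mul_le_of_le_one_right (norm_nonneg _)
      (mul_le_one₀ hu (norm_nonneg _) hS)).trans_lt hp
  exact (pow_lt_one_iff_of_nonneg (norm_nonneg _) hpp.ne_zero).1 hlt

lemma exists_pow_prime_pow_eq_of_norm_sub_one_lt_one (hp : ‖(p : C)‖ < 1)
    (hroot : ∀ x : C, ∃ y : C, y ^ p = x) (k : ℕ) {x : C} (hx : ‖x - 1‖ < 1) :
    ∃ y : C, ‖y - 1‖ < 1 ∧ y ^ p ^ k = x := by
  induction k with
  | zero => exact ⟨x, hx, by simp⟩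
  | succ k ih =>
    obtain ⟨w, hw, rfl⟩ := ih
    obtain ⟨y, rfl⟩ := hroot w
    exact ⟨y, norm_sub_one_lt_one_of_norm_pow_sub_one_lt_one p hp hw, by
      rw [← pow_mul, pow_succ']⟩

lemma add_two_mul_quarter_pow_le (n : ℕ) : ((n : ℝ) + 2) * (1 / 4) ^ (n + 1) ≤ 1 / 2 := by
  induction n with
  | zero => norm_num
  | succ n ih =>
    refine le_trans ?_ ih
    push_cast
    rw [pow_succ _ (n + 1)]
    have : (0 : ℝ) < (1 / 4) ^ (n + 1) := by positivity
    nlinarith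

lemma norm_log1p_sub_log1p_sub_le [NormedAlgebra ℚ_[p] C] [CompleteSpace C] {u v : C}
    (hu : ‖u‖ ≤ 1 / 4) (hv : ‖v‖ ≤ 1 / 4) :
    ‖log1p u - log1p v - (u - v)‖ ≤ 1 / 2 * ‖u - v‖ := by
  have hsu := summable_log1p_term p (hu.trans_lt (by norm_num : (1 / 4 : ℝ) < 1))
  have hsv := summable_log1p_term p (hv.trans_lt (by norm_num : (1 / 4 : ℝ) < 1))
  rw [log1p, log1p, ← hsu.tsum_sub hsv, (hsu.sub hsv).tsum_eq_zero_add]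
  simp only [pow_zero, one_mul, zero_add, pow_one, Nat.cast_zero, div_one, add_sub_cancel_left]
  refine IsUltrametricDist.norm_tsum_le_of_forall_le fun n ↦ ?_
  have hn := norm_natCast_add_one_inv_le (C := C) p (n + 1)
  have hd := norm_pow_succ_sub_pow_succ_le hu hv (n + 1)
  rw [← sub_div, ← mul_sub, div_eq_mul_inv, norm_mul, norm_mul, norm_pow, norm_neg, norm_one,
    one_pow, one_mul]
  calc _ ≤ ((1 / 4) ^ (n + 1) * ‖u - v‖) * (((n + 1 : ℕ) : ℝ) + 1) := by gcongr
    _ = (((n : ℝ) + 2) * (1 / 4) ^ (n + 1)) * ‖u - v‖ := by push_cast; ring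
    _ ≤ _ := by gcongr; exact add_two_mul_quarter_pow_le n

lemma exists_log1p_eq_of_norm_le [NormedAlgebra ℚ_[p] C] [CompleteSpace C] {c : C}
    (hc : ‖c‖ ≤ 1 / 8) : ∃ z : C, ‖z‖ < 1 ∧ log1p z = c := by
  have happ : ApproximatesLinearOn (log1p : C → C)
      (ContinuousLinearEquiv.refl ℚ_[p] C : C →L[ℚ_[p]] C) (closedBall 0 (1 / 4)) (1 / 2) := by
    intro u hu v hv
    rw [mem_closedBall_zero_iff] at hu hv
    simpa using norm_log1p_sub_log1p_sub_le p hu hv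
  have hone : ((ContinuousLinearEquiv.refl ℚ_[p] C).toNonlinearRightInverse.nnnorm : ℝ) = 1 :=
    ContinuousLinearMap.norm_id
  have hsurj := happ.surjOn_closedBall_of_nonlinearRightInverse
    (ContinuousLinearEquiv.refl ℚ_[p] C).toNonlinearRightInverse (by norm_num) subset_rfl
  have h0 : log1p (0 : C) = 0 := by simp [log1p]
  obtain ⟨z, hz, rfl⟩ := hsurj (show c ∈ _ by
    rw [hone, h0, mem_closedBall_zero_iff]
    convert hc using 1
    norm_num)
  exact ⟨z, (mem_closedBall_zero_iff.1 hz).trans_lt (by norm_num), rfl⟩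

end PadicField

/-- **Surjectivity of the `p`-adic logarithm.** Let `C` be a complete field with a
nonarchimedean multiplicative norm extending the `p`-adic absolute value on `ℚ_p`, in
which every element admits a `p`-th root. Then `z ↦ log (1+z)` maps the open unit disc
`{z : ‖z‖ < 1}` onto `C`. -/
theorem padic_log_surjective (p : ℕ) [Fact p.Prime]
    (C : Type*) [NormedField C] [CompleteSpace C] [IsUltrametricDist C]
    [Algebra ℚ_[p] C] (hext : ∀ x : ℚ_[p], ‖algebraMap ℚ_[p] C x‖ = ‖x‖)
    (hroot : ∀ x : C, ∃ y : C, y ^ p = x) :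
    ∀ c : C, ∃ z : C, ‖z‖ < 1 ∧ log1p z = c := by
  let _ : NormedAlgebra ℚ_[p] C :=
    { ‹Algebra ℚ_[p] C› with
      norm_smul_le := fun r x ↦ by rw [Algebra.smul_def, norm_mul, hext] }
  have : CharZero C := charZero_of_injective_algebraMap (algebraMap ℚ_[p] C).injective
  intro c
  have hp := norm_natCast_self_lt_one (C := C) p
  have hp0 : (p : C) ≠ 0 := Nat.cast_ne_zero.2 (Fact.out : p.Prime).ne_zero
  obtain ⟨k, hk⟩ : ∃ k : ℕ, ‖(p : C) ^ k * c‖ ≤ 1 / 8 := by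
    have h : Tendsto (fun k : ℕ ↦ ‖(p : C) ^ k * c‖) atTop (𝓝 0) := by
      simpa using ((tendsto_pow_atTop_nhds_zero_of_norm_lt_one hp).mul_const c).norm
    exact (h.eventually_le_const (by norm_num)).exists
  obtain ⟨w, hw, hlog⟩ := exists_log1p_eq_of_norm_le p hk
  obtain ⟨y, hy, hyw⟩ := exists_pow_prime_pow_eq_of_norm_sub_one_lt_one p hp hroot k
    (x := 1 + w) (by simpa using hw)
  refine ⟨y - 1, hy, mul_left_cancel₀ (pow_ne_zero k hp0) ?_⟩
  rw [← log1p_one_add_pow_sub_one p hy, add_sub_cancel, hyw, add_sub_cancel_left, hlog]
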